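/- Let C be a nontrivial class of groups that is closed under taking finite direct products and contains a root class R, such that every R-by-C group belongs to C (i.e., every group having a normal subgroup N with N ∈ R and quotient in C belongs to C), and such that for every group in C there exists a group in R of the same cardinality. Then every free-by-C group is residually C: if G has a normal subgroup N ⊴ G with N a free group and G/N ∈ C, then G is residually C. -/

import Mathlib

universe u

open Monoid

/-- A group `G` is *residually `C`*: every nontrivial element survives in a
surjective homomorphic image lying in the class `C`. -/
def ResiduallyC (C : ∀ (G : Type u) [Group G], Prop) (G : Type u) [Group G] : Prop :=
  ∀ g : G, g ≠ 1 → ∃ (Q : Type u) (_ : Group Q) (φ : G →* Q),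
    C Q ∧ Function.Surjective φ ∧ φ g ≠ 1
/-- `R` is a *root class*: it is closed under isomorphism, contains a
nontrivial group, is closed under taking subgroups, and for every subnormal
series `K ⊴ H ⊴ G` with `G/H ∈ R` and `H/K ∈ R` there is a normal subgroup
`L ⊴ G` with `L ≤ K` and `G/L ∈ R`. -/
def IsRootClass (R : ∀ (G : Type u) [Group G], Prop) : Prop :=
  (∀ (G H : Type u) [Group G] [Group H], G ≃* H → R G → R H) ∧
  (∃ (G : Type u) (_ : Group G), R G ∧ Nontrivial G) ∧
  (∀ (G : Type u) [Group G] (H : Subgroup G), R G → R H) ∧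
  (∀ (G : Type u) [Group G] (H K : Subgroup G) (_ : H.Normal) (_ : K ≤ H)
      (_ : (K.subgroupOf H).Normal),
      R (G ⧸ H) → R (H ⧸ K.subgroupOf H) →
      ∃ (L : Subgroup G) (_ : L.Normal), L ≤ K ∧ R (G ⧸ L))

namespace IsRootClass

variable {R : ∀ (G : Type u) [Group G], Prop}

theorem of_injective (hR : IsRootClass R) {G H : Type u} [Group G] [Group H] (hH : R H)
    (f : G →* H) (hf : Function.Injective f) : R G :=
  hR.1 _ _ (MonoidHom.ofInjective hf).symm (hR.2.2.1 H f.range hH)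

/-- A root class is closed under regular wreath products. -/
theorem regularWreathProduct (hR : IsRootClass R) {X Y : Type u} [Group X] [Group Y]
    (hX : R X) (hY : R Y) : R (X ≀ᵣ Y) := by
  let π : X ≀ᵣ Y →* Y := RegularWreathProduct.rightHom
  have right_eq_one (f : π.ker) : f.1.right = 1 := f.2
  let ev : π.ker →* X :=
    { toFun f := f.1.left 1
      map_one' := rfl
      map_mul' f g := by simp [right_eq_one f] }
  let K : Subgroup (X ≀ᵣ Y) := ev.ker.map π.ker.subtype
  have hKπ : K ≤ π.ker := Subgroup.map_subtype_le _
  have hK : K.subgroupOf π.ker = ev.ker :=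
    Subgroup.comap_map_eq_self_of_injective π.ker.subtype_injective _
  have hKn : (K.subgroupOf π.ker).Normal := hK ▸ inferInstance
  have hπ : Function.Surjective π := fun y ↦ ⟨⟨1, y⟩, rfl⟩
  have hev : Function.Surjective ev := fun x ↦ ⟨⟨⟨fun _ ↦ x, 1⟩, rfl⟩, rfl⟩
  obtain ⟨L, hLn, hLK, hL⟩ := hR.2.2.2 (X ≀ᵣ Y) π.ker K inferInstance hKπ hKn
    (hR.1 _ _ (QuotientGroup.quotientKerEquivOfSurjective π hπ).symm hY)
    (hR.1 _ _ ((QuotientGroup.quotientMulEquivOfEq hK).trans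
      (QuotientGroup.quotientKerEquivOfSurjective ev hev)).symm hX)
  have hLbot : L = ⊥ := by
    rw [eq_bot_iff]
    intro f hf
    have hright : f.right = 1 := hKπ (hLK hf)
    have hleft (y : Y) : f.left y = 1 := by
      obtain ⟨k, hk, hkf⟩ := hLK (hLn.conj_mem f hf (RegularWreathProduct.inl y⁻¹))
      have : k.1.left 1 = 1 := hk
      rw [show k.1 = _ from hkf] at this
      simpa using this
    rw [Subgroup.mem_bot]
    ext y
    · exact hleft y
    · exact hright
  subst hLbot
  exact hR.1 _ _ QuotientGroup.quotientBot hL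

theorem pi (hR : IsRootClass R) {X Y : Type u} [Group X] [Group Y] (hX : R X) (hY : R Y) :
    R (Y → X) :=
  hR.of_injective (hR.regularWreathProduct hX hY)
    { toFun f := ⟨f, 1⟩
      map_one' := rfl
      map_mul' f g := by ext <;> simp }
    fun _ _ h ↦ congrArg RegularWreathProduct.left h

theorem prod (hR : IsRootClass R) {X Y : Type u} [Group X] [Group Y] (hX : R X) (hY : R Y) :
    R (X × Y) :=
  hR.of_injective (hR.regularWreathProduct hX hY)
    { toFun p := ⟨fun _ ↦ p.1, p.2⟩
      map_one' := rfl
      map_mul' p q := by ext <;> simp }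
    fun _ _ h ↦ Prod.ext (congrFun (congrArg RegularWreathProduct.left h) 1)
      (congrArg RegularWreathProduct.right h)

/-- Finitely many elements, each of which survives in some member of a root class, survive
simultaneously in a member of that class. -/
theorem exists_hom_forall_mem_ne_one (hR : IsRootClass R) {F : Type*} [Group F] (l : List F)
    (hl : ∀ g ∈ l, ∃ (Q : Type u) (_ : Group Q) (φ : F →* Q), R Q ∧ φ g ≠ 1) :
    ∃ (Q : Type u) (_ : Group Q) (φ : F →* Q), R Q ∧ ∀ g ∈ l, φ g ≠ 1 := by
  induction l with
  | nil =>
    obtain ⟨A, _, hA, -⟩ := hR.2.1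
    exact ⟨A, _, 1, hA, by simp⟩
  | cons g l ih =>
    obtain ⟨Q, _, φ, hQ, hφ⟩ := ih fun h hh ↦ hl h (List.mem_cons_of_mem _ hh)
    obtain ⟨P, _, ψ, hP, hψ⟩ := hl g List.mem_cons_self
    refine ⟨P × Q, _, ψ.prod φ, hR.prod hP hQ, fun h hh heq ↦ ?_⟩
    rw [MonoidHom.prod_apply, Prod.mk_eq_one] at heq
    rcases List.mem_cons.1 hh with rfl | hh
    · exact hψ heq.1
    · exact hφ h hh heq.2

end IsRootClass

namespace FreeGroup

variable {α A Q : Type*} [Group A] [Group Q]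

open scoped Classical in
/-- The homomorphism to the regular wreath product `A ≀ᵣ Q` that lifts `φ` and marks by `a` the
edge labelled `x` starting at `c` in the Cayley graph of `Q`. -/
noncomputable def markEdge (φ : FreeGroup α →* Q) (x : α) (c : Q) (a : A) :
    FreeGroup α →* A ≀ᵣ Q :=
  lift fun y ↦ ⟨fun z ↦ if y = x ∧ z = c then a else 1, φ (of y)⟩

theorem markEdge_right (φ : FreeGroup α →* Q) (x : α) (c : Q) (a : A) (w : FreeGroup α) :
    (markEdge φ x c a w).right = φ w := by
  have : RegularWreathProduct.rightHom.comp (markEdge φ x c a) = φ := by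
    ext y
    simp [markEdge]
  exact DFunLike.congr_fun this w

open scoped Classical in
theorem markEdge_mk_singleton_left (φ : FreeGroup α →* Q) (x : α) (c : Q) (a : A)
    (y : α) (b : Bool) (z : Q) :
    (markEdge φ x c a (mk [(y, b)])).left z =
      if y = x ∧ z = (if b then c else (φ (of x))⁻¹ * c) then (if b then a else a⁻¹) else 1 := by
  cases b
  · by_cases hy : y = x
    · subst hy
      have hz : φ (of y) * z = c ↔ z = (φ (of y))⁻¹ * c := eq_inv_mul_iff_mul_eq.symm
      by_cases h : z = (φ (of y))⁻¹ * c <;> simp [markEdge, lift_mk, hz, h]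
    · simp [markEdge, lift_mk, hy]
  · simp [markEdge, lift_mk]

theorem markEdge_left_eq_one (φ : FreeGroup α →* Q) (x : α) (c : Q) (a : A)
    (L : List (α × Bool)) (z : Q)
    (h : ∀ L₁ l L₂, L = L₁ ++ l :: L₂ →
      (markEdge φ x c a (mk [l])).left ((φ (mk L₁))⁻¹ * z) = 1) :
    (markEdge φ x c a (mk L)).left z = 1 := by
  induction L generalizing z with
  | nil => rw [← one_eq_mk, _root_.map_one]; rfl
  | cons l L ih =>
    have hl := h [] l L rfl
    rw [← one_eq_mk, _root_.map_one, inv_one, one_mul] at hl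
    have hsplit (M : List (α × Bool)) : (mk (l :: M) : FreeGroup α) = mk [l] * mk M := by simp
    rw [hsplit, _root_.map_mul, RegularWreathProduct.mul_left, Pi.mul_apply, hl, one_mul,
      markEdge_right]
    refine ih _ fun L₁ l' L₂ hL ↦ ?_
    have := h (l :: L₁) l' L₂ (by rw [hL]; rfl)
    rwa [hsplit, _root_.map_mul, mul_inv_rev, mul_assoc] at this

/-- If all nonempty proper subwords of a reduced word survive in `Q`, then the word itself
survives in `A ≀ᵣ Q` for every nontrivial group `A`. -/
theorem exists_hom_regularWreathProduct_ne_one [Nontrivial A] (φ : FreeGroup α →* Q)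
    {L : List (α × Bool)} (hL : IsReduced L) (hne : L ≠ [])
    (h : ∀ M, M <:+: L → M ≠ [] → M.length < L.length → φ (mk M) ≠ 1) :
    ∃ ψ : FreeGroup α →* A ≀ᵣ Q, ψ (mk L) ≠ 1 := by
  classical
  obtain ⟨a, ha⟩ := exists_ne (1 : A)
  obtain _ | ⟨⟨x, b⟩, L⟩ := L
  · exact absurd rfl hne
  let c : Q := if b then 1 else φ (of x)
  have hletter : φ (mk [(x, b)]) = if b then φ (of x) else (φ (of x))⁻¹ := by
    cases b
    · rw [← _root_.map_inv]; rfl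
    · rfl
  have hsplit (M : List (α × Bool)) :
      (mk ((x, b) :: M) : FreeGroup α) = mk [(x, b)] * mk M := by simp
  refine ⟨markEdge φ x c a, fun heq ↦ ?_⟩
  have hleft : (markEdge φ x c a (mk ((x, b) :: L))).left 1 = 1 := by rw [heq]; rfl
  rw [hsplit, _root_.map_mul, RegularWreathProduct.mul_left, Pi.mul_apply, markEdge_right,
    markEdge_left_eq_one (L := L), mul_one, markEdge_mk_singleton_left] at hleft
  · cases b <;> simp [c, ha] at hleft
  rintro L₁ ⟨y, b'⟩ L₂ rfl
  rw [markEdge_mk_singleton_left, if_neg]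
  rintro ⟨rfl, hz⟩
  rw [mul_one, ← mul_inv_rev] at hz
  by_cases hb : b' = b
  · subst hb
    refine h ((y, b') :: L₁) ⟨[], (y, b') :: L₂, by simp⟩ (by simp) (by simp) ?_
    rw [hsplit, _root_.map_mul, ← inv_eq_one, hz]
    cases b' <;> simp [c]
  · have hL₁ : φ (mk L₁) = 1 := by
      rw [hletter, inv_eq_iff_eq_inv] at hz
      cases b <;> cases b' <;> first | exact absurd rfl hb | simpa [c] using hz
    obtain rfl : L₁ = [] := by
      by_contra hne₁
      exact h L₁ ⟨[(y, b)], (y, b') :: L₂, by simp⟩ hne₁ (by simp) hL₁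
    exact hb ((isReduced_cons_cons.1 hL).1 rfl).symm

end FreeGroup

namespace IsRootClass

variable {R : ∀ (G : Type u) [Group G], Prop}

theorem exists_hom_freeGroup_mk_ne_one (hR : IsRootClass R) {α : Type*} (L : List (α × Bool))
    (hL : FreeGroup.IsReduced L) (hne : L ≠ []) :
    ∃ (Q : Type u) (_ : Group Q) (φ : FreeGroup α →* Q), R Q ∧ φ (FreeGroup.mk L) ≠ 1 := by
  classical
  induction hn : L.length using Nat.strong_induction_on generalizing L with
  | _ n ih =>
    subst hn
    obtain ⟨Q, _, φ, hQ, hφ⟩ := hR.exists_hom_forall_mem_ne_one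
      ((L.sublists.filter fun M ↦ FreeGroup.IsReduced M ∧ M ≠ [] ∧ M.length < L.length).map
        FreeGroup.mk) (by
          intro g hg
          obtain ⟨M, hM, rfl⟩ := List.mem_map.1 hg
          obtain ⟨hM₁, hM₂, hM₃⟩ := of_decide_eq_true (List.mem_filter.1 hM).2
          exact ih _ hM₃ M hM₁ hM₂ rfl)
    obtain ⟨A, _, hA, _⟩ := hR.2.1
    obtain ⟨ψ, hψ⟩ := FreeGroup.exists_hom_regularWreathProduct_ne_one (A := A) φ hL hne
      fun M hM hM₁ hM₂ ↦ hφ _ (List.mem_map_of_mem (List.mem_filter.2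
        ⟨List.mem_sublists.2 hM.sublist, decide_eq_true ⟨hL.infix hM, hM₁, hM₂⟩⟩))
    exact ⟨A ≀ᵣ Q, _, ψ, hR.regularWreathProduct hA hQ, hψ⟩

/-- Every nontrivial element of a free group survives in a member of any given root class. -/
theorem exists_hom_ne_one_of_isFreeGroup (hR : IsRootClass R) {F : Type*} [Group F]
    [IsFreeGroup F] {g : F} (hg : g ≠ 1) :
    ∃ (Q : Type u) (_ : Group Q) (φ : F →* Q), R Q ∧ φ g ≠ 1 := by
  classical
  let e := IsFreeGroup.toFreeGroup F
  obtain ⟨Q, _, φ, hQ, hφ⟩ := hR.exists_hom_freeGroup_mk_ne_one (e g).toWord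
    FreeGroup.isReduced_toWord (by simpa using hg)
  exact ⟨Q, _, φ.comp e.toMonoidHom, hQ, by simpa [FreeGroup.mk_toWord] using hφ⟩

/-- If `M` is normal in the normal subgroup `N` of `G`, with `N ⧸ M` in a root class containing
a group equipotent to `G ⧸ N`, then the image of `N` in the quotient of `G` by the normal core
of `M` lies in the root class. -/
theorem map_mk'_normalCore (hR : IsRootClass R) {G X Y : Type u} [Group G] [Group X] [Group Y]
    (N : Subgroup G) [N.Normal] (ψ : N →* X) (hX : R X) (hY : R Y) (e : (G ⧸ N) ≃ Y) :
    R (N.map (QuotientGroup.mk' (ψ.ker.map N.subtype).normalCore)) := by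
  set L := (ψ.ker.map N.subtype).normalCore
  let Φ : N →* Y → X := MonoidHom.pi fun y ↦
    ψ.comp (MulAut.conjNormal (e.symm y).out⁻¹).toMonoidHom
  let Ψ : N →* G ⧸ L := (QuotientGroup.mk' L).comp N.subtype
  have hker : Ψ.ker = Φ.ker := by
    ext n
    have hmem (n : N) : (n : G) ∈ ψ.ker.map N.subtype ↔ ψ n = 1 := by
      simp [MonoidHom.mem_ker]
    have hL : n ∈ Ψ.ker ↔ ∀ g : G, ψ (MulAut.conjNormal g n) = 1 := by
      rw [MonoidHom.mem_ker]
      refine (QuotientGroup.eq_one_iff (n : G)).trans (forall_congr' fun g ↦ ?_)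
      rw [← hmem, MulAut.conjNormal_apply]
    rw [hL, MonoidHom.mem_ker]
    refine ⟨fun h ↦ funext fun y ↦ h _, fun h g ↦ ?_⟩
    obtain ⟨m, hm⟩ := QuotientGroup.mk_out_eq_mul N g⁻¹
    have hg : g = m * ((g⁻¹ : G) : G ⧸ N).out⁻¹ := by
      rw [hm]; group
    have hn : ψ (MulAut.conjNormal ((g⁻¹ : G) : G ⧸ N).out⁻¹ n) = 1 := by
      simpa [Φ] using congrFun h (e ((g⁻¹ : G) : G ⧸ N))
    have hconj : MulAut.conjNormal g n =
        m * MulAut.conjNormal ((g⁻¹ : G) : G ⧸ N).out⁻¹ n * m⁻¹ := by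
      conv_lhs => rw [hg, _root_.map_mul]
      ext
      simp
    rw [hconj, _root_.map_mul, _root_.map_mul, hn, mul_one, ← _root_.map_mul, mul_inv_cancel,
      _root_.map_one]
  have hrange : N.map (QuotientGroup.mk' L) = Ψ.range := by
    rw [MonoidHom.range_comp, N.range_subtype]
  rw [hrange]
  exact hR.1 _ _ ((QuotientGroup.quotientKerEquivRange Φ).symm.trans
    ((QuotientGroup.quotientMulEquivOfEq hker.symm).trans
      (QuotientGroup.quotientKerEquivRange Ψ))) (hR.2.2.1 _ _ (hR.pi hX hY))

end IsRootClass


/-- If `C` is a nontrivial class of groups closed under isomorphism and finite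
direct products, containing a root class `R`, such that every `R`-by-`C` group
belongs to `C` and every group in `C` admits a group in `R` of the same
cardinality, then every free-by-`C` group is residually `C`. -/
theorem free_by_C_residuallyC
    (C R : ∀ (G : Type u) [Group G], Prop)
    (hCIso : ∀ (G H : Type u) [Group G] [Group H], G ≃* H → C G → C H)
    (hCnontriv : ∃ (G : Type u) (_ : Group G), C G ∧ Nontrivial G)
    (hProd : ∀ (G H : Type u) [Group G] [Group H], C G → C H → C (G × H))
    (hR : IsRootClass R)
    (hRC : ∀ (G : Type u) [Group G], R G → C G)
    (hRbyC : ∀ (G : Type u) [Group G] (N : Subgroup G) (_ : N.Normal),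
      R N → C (G ⧸ N) → C G)
    (hcard : ∀ (G : Type u) [Group G], C G →
      ∃ (H : Type u) (_ : Group H), R H ∧ Nonempty (G ≃ H))
    (G : Type u) [Group G] (N : Subgroup G) [N.Normal]
    (hNfree : IsFreeGroup N) (hquot : C (G ⧸ N)) :
    ResiduallyC C G := by
  intro g hg
  by_cases hgN : g ∈ N
  · obtain ⟨X, _, ψ, hX, hψ⟩ := hR.exists_hom_ne_one_of_isFreeGroup (g := (⟨g, hgN⟩ : N))
      (by simpa [Subtype.ext_iff] using hg)
    obtain ⟨Y, _, hY, ⟨e⟩⟩ := hcard _ hquot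
    set L := (ψ.ker.map N.subtype).normalCore
    have hLψ : L ≤ ψ.ker.map N.subtype := Subgroup.normalCore_le _
    have hLN : L ≤ N := hLψ.trans (Subgroup.map_subtype_le _)
    refine ⟨G ⧸ L, inferInstance, QuotientGroup.mk' L, ?_, QuotientGroup.mk'_surjective L, ?_⟩
    · exact hRbyC _ (N.map (QuotientGroup.mk' L)) inferInstance
        (hR.map_mk'_normalCore N ψ hX hY e)
        (hCIso _ _ (QuotientGroup.quotientQuotientEquivQuotient L N hLN).symm hquot)
    · intro h
      obtain ⟨n, hn, hng⟩ := hLψ ((QuotientGroup.eq_one_iff g).1 h)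
      obtain rfl : n = ⟨g, hgN⟩ := Subtype.ext hng
      exact hψ hn
  · exact ⟨G ⧸ N, inferInstance, QuotientGroup.mk' N, hquot, QuotientGroup.mk'_surjective N,
      fun h ↦ hgN ((QuotientGroup.eq_one_iff g).1 h)⟩
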